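/- Suppose there exists t₀ > 0 with P_X(0 < |η(X) − 1/2| ≤ t₀) = 0, and let η̂_n be any estimator of the regression function η. Then the plug-in classifier f̂_n = 1{η̂_n ≥ 1/2} satisfies E[R(f̂_n)] − R(f*) ≤ P(|η̂_n(X) − η(X)| > t₀), where P on the right-hand side is the joint probability over the sample and an independent X ∼ P_X. -/

import Mathlib

open MeasureTheory ENNReal Matrix
open scoped Classical

noncomputable section

abbrev Euc (d : ℕ) := EuclideanSpace ℝ (Fin d)

/-- Margin (low noise) assumption (MA) with parameters `α`, `C₀`:
`P_X(0 < |η(X) − 1/2| ≤ t) ≤ C₀ t^α` for all `t > 0`. -/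
def margin (d : ℕ) (α C₀ : ℝ) (PX : Measure (Euc d)) (η : Euc d → ℝ) : Prop :=
  ∀ t : ℝ, 0 < t →
    PX {x | 0 < |η x - 1/2| ∧ |η x - 1/2| ≤ t} ≤ ENNReal.ofReal (C₀ * t ^ α)

/-- The plug-in rule `1{η ≥ 1/2}`; applied to the true regression function this is
the Bayes rule `f*`. -/
def plugin (d : ℕ) (η : Euc d → ℝ) : Euc d → Bool :=
  fun x => if 1/2 ≤ η x then true else false

/-- Excess risk `R(f) − R(f*) = E[|2η(X)−1| 1{f(X) ≠ f*(X)}]`. -/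
def excessRisk (d : ℕ) (PX : Measure (Euc d)) (η : Euc d → ℝ) (f : Euc d → Bool) : ℝ :=
  ∫ x, (if f x = plugin d η x then 0 else |2 * η x - 1|) ∂PX

/-- Joint distribution `P` of `(X,Y)` on `ℝ^d × ℝ` (with `Y ∈ {0,1}`) determined by the
marginal `PX` of `X` and the regression function `η(x) = P(Y = 1 | X = x)`. -/
def joint (d : ℕ) (PX : Measure (Euc d)) (η : Euc d → ℝ) : Measure (Euc d × ℝ) :=
  PX.bind fun x =>
    ENNReal.ofReal (η x) • Measure.dirac (x, (1:ℝ)) +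
      ENNReal.ofReal (1 - η x) • Measure.dirac (x, (0:ℝ))

/-- Law `P^⊗n` of the i.i.d. sample `(X₁,Y₁),…,(Xₙ,Yₙ)`. -/
def sampleLaw (d n : ℕ) (PX : Measure (Euc d)) (η : Euc d → ℝ) :
    Measure (Fin n → Euc d × ℝ) :=
  Measure.pi fun _ => joint d PX η

/-- Expected excess risk `E[R(f̂ₙ)] − R(f*)` of a classifier `f̂ₙ`. -/
def expectedExcess (d n : ℕ) (PX : Measure (Euc d)) (η : Euc d → ℝ)
    (fhat : (Fin n → Euc d × ℝ) → Euc d → Bool) : ℝ :=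
  ∫ D, excessRisk d PX η (fhat D) ∂(sampleLaw d n PX η)

/-- The joint law of `(X, Y)` is a probability measure. -/
theorem isProbabilityMeasure_joint (d : ℕ) (PX : Measure (Euc d)) [IsProbabilityMeasure PX]
    (η : Euc d → ℝ) (hmeas : Measurable η) (hrange : ∀ x, η x ∈ Set.Icc (0:ℝ) 1) :
    IsProbabilityMeasure (joint d PX η) := by
  have hκ : Measurable fun x : Euc d =>
      ENNReal.ofReal (η x) • Measure.dirac (x, (1:ℝ)) +
        ENNReal.ofReal (1 - η x) • Measure.dirac (x, (0:ℝ)) := by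
    refine Measure.measurable_of_measurable_coe _ fun s hs => ?_
    simp only [Measure.add_apply, Measure.smul_apply, Measure.dirac_apply' _ hs, smul_eq_mul]
    have hind (y : ℝ) : Measurable fun x : Euc d =>
        s.indicator (1 : Euc d × ℝ → ℝ≥0∞) (x, y) :=
      (measurable_one.indicator hs).comp (measurable_id.prodMk measurable_const)
    exact (hmeas.ennreal_ofReal.mul (hind 1)).add
      ((measurable_const.sub hmeas).ennreal_ofReal.mul (hind 0))
  constructor
  rw [joint, Measure.bind_apply MeasurableSet.univ hκ.aemeasurable]
  have hone (x : Euc d) : ENNReal.ofReal (η x) + ENNReal.ofReal (1 - η x) = 1 := by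
    rw [← ENNReal.ofReal_add (hrange x).1 (sub_nonneg.2 (hrange x).2)]
    simp
  simp [hone]

/-- Where the plug-in rules of `g` and `η` disagree, the distance from `η` to `g` is at least
the distance from `η` to the threshold `1/2`. -/
theorem abs_sub_half_le_of_plugin_ne {d : ℕ} {g η : Euc d → ℝ} {x : Euc d}
    (h : plugin d g x ≠ plugin d η x) : |η x - 1/2| ≤ |g x - η x| := by
  unfold plugin at h
  by_cases h₁ : 1/2 ≤ g x <;> by_cases h₂ : 1/2 ≤ η x <;>
    simp only [h₁, h₂, if_true, if_false, ne_eq, not_true] at h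
  · rw [abs_of_neg (by linarith), abs_of_nonneg (by linarith)]
    linarith
  · rw [abs_of_nonneg (by linarith), abs_of_neg (by linarith)]
    linarith

theorem measurable_plugin_comp {α : Type*} [MeasurableSpace α] {f : α → ℝ} (hf : Measurable f) :
    Measurable fun a => if 1/2 ≤ f a then true else false :=
  Measurable.ite (measurableSet_le measurable_const hf) measurable_const measurable_const

theorem statement10 (d n : ℕ) (t₀ : ℝ) (ht₀ : 0 < t₀)
    (PX : Measure (Euc d)) (η : Euc d → ℝ) (hprob : IsProbabilityMeasure PX)
    (hmeas : Measurable η) (hrange : ∀ x, η x ∈ Set.Icc (0:ℝ) 1)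
    (hzero : PX {x | 0 < |η x - 1/2| ∧ |η x - 1/2| ≤ t₀} = 0)
    (ηhat : (Fin n → Euc d × ℝ) → Euc d → ℝ)
    (hhat : Measurable (Function.uncurry ηhat)) :
    expectedExcess d n PX η (fun D => plugin d (ηhat D)) ≤
      (((sampleLaw d n PX η).prod PX) {q | t₀ < |ηhat q.1 q.2 - η q.2|}).toReal := by
  have := isProbabilityMeasure_joint d PX η hmeas hrange
  have : IsProbabilityMeasure (sampleLaw d n PX η) := by
    unfold sampleLaw
    infer_instance
  set μ := (sampleLaw d n PX η).prod PX
  set loss : (Fin n → Euc d × ℝ) × Euc d → ℝ := fun q =>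
    if plugin d (ηhat q.1) q.2 = plugin d η q.2 then 0 else |2 * η q.2 - 1| with hloss
  set S := {q : (Fin n → Euc d × ℝ) × Euc d | t₀ < |ηhat q.1 q.2 - η q.2|}
  have hη : Measurable fun q : (Fin n → Euc d × ℝ) × Euc d => η q.2 := hmeas.comp measurable_snd
  have hS : MeasurableSet S := measurableSet_lt measurable_const (hhat.sub hη).abs
  have hloss_meas : Measurable loss :=
    Measurable.ite
      (measurableSet_eq_fun (measurable_plugin_comp hhat) (measurable_plugin_comp hη))
      measurable_const ((hη.const_mul 2).sub_const 1).abs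
  have hle_one (x : Euc d) : |2 * η x - 1| ≤ 1 := by
    obtain ⟨h0, h1⟩ := hrange x
    exact abs_le.2 ⟨by linarith, by linarith⟩
  have hint : Integrable loss μ := by
    refine Integrable.of_bound hloss_meas.aestronglyMeasurable 1 (.of_forall fun q => ?_)
    simp only [hloss]
    split_ifs
    · simp
    · simpa using hle_one q.2
  have hmargin : ∀ᵐ q ∂μ, ¬ (0 < |η q.2 - 1/2| ∧ |η q.2 - 1/2| ≤ t₀) := by
    refine Measure.quasiMeasurePreserving_snd.ae (p := fun x =>
      ¬ (0 < |η x - 1/2| ∧ |η x - 1/2| ≤ t₀)) ?_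
    rw [ae_iff]
    simpa only [not_not] using hzero
  calc expectedExcess d n PX η (fun D => plugin d (ηhat D))
      = ∫ q, loss q ∂μ := (integral_prod loss hint).symm
    _ ≤ ∫ q, S.indicator 1 q ∂μ := by
        refine integral_mono_ae hint ((integrable_const (1:ℝ)).indicator hS) ?_
        filter_upwards [hmargin] with q hq
        have hnonneg : (0:ℝ) ≤ S.indicator 1 q :=
          Set.indicator_nonneg (fun _ _ => zero_le_one) q
        simp only [hloss]
        split_ifs with h
        · exact hnonneg
        · have hdist := abs_sub_half_le_of_plugin_ne h
          rcases (abs_nonneg (η q.2 - 1/2)).eq_or_lt with h0 | hpos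
          · have h_half : η q.2 = 1/2 := sub_eq_zero.1 (abs_eq_zero.1 h0.symm)
            have hzero_loss : |2 * η q.2 - 1| = 0 := by rw [h_half]; norm_num
            rwa [hzero_loss]
          · have hqS : q ∈ S := (not_le.1 fun hle => hq ⟨hpos, hle⟩).trans_le hdist
            rw [Set.indicator_of_mem hqS]
            exact hle_one q.2
    _ = (μ S).toReal := integral_indicator_one hS
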